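/- Let m be odd, let α, β ∈ 𝔽_{q^m} with α ≠ 0 and β ≠ 0, let λ ∈ 𝔽_q with λ ≠ 0, and set N₃ = Σ_{a,b ∈ 𝔽_{q^m}} Σ_{x ∈ 𝔽_q\{0}} Σ_{y ∈ 𝔽_q\{0}} Σ_{z ∈ 𝔽_q\{0}} ζ_q^{x·Tr(a²)} · ζ_q^{y·Tr(b²)} · ζ_q^{z·Tr(αb + βa) − zλ} ∈ ℂ. Then: N₃ = −η̄(Tr(α²)·Tr(β²))·G²·Ḡ² if Tr(α²) ≠ 0 and Tr(β²) ≠ 0; and N₃ = 0 if Tr(α²) = 0 or Tr(β²) = 0. -/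

import Mathlib

open Finset

/-- The additive character `s ↦ exp(2πi·s̃/q)` of `ZMod q`. -/
noncomputable def zetaQ (q : ℕ) (s : ZMod q) : ℂ :=
  Complex.exp (2 * Real.pi * Complex.I * (s.val : ℂ) / (q : ℂ))

/-- The quadratic Gauss sum `G` over the big field `F`. -/
noncomputable def gaussBig (q : ℕ) [Fact q.Prime] (F : Type*) [Field F] [Fintype F]
    [DecidableEq F] [Algebra (ZMod q) F] : ℂ :=
  ∑ x ∈ Finset.univ.filter (fun x : F => x ≠ 0),
    (quadraticChar F x : ℂ) * zetaQ q (Algebra.trace (ZMod q) F x)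

/-- The quadratic Gauss sum `Ḡ` over the prime field `ZMod q`. -/
noncomputable def gaussSmall (q : ℕ) [Fact q.Prime] : ℂ :=
  ∑ y ∈ Finset.univ.filter (fun y : ZMod q => y ≠ 0),
    (quadraticChar (ZMod q) y : ℂ) * zetaQ q y

/-- The character sum `N₃` of Lemma 3.4. -/
noncomputable def Nthree (q : ℕ) [Fact q.Prime] (F : Type*) [Field F] [Fintype F]
    [DecidableEq F] [Algebra (ZMod q) F] (α β : F) (lam : ZMod q) : ℂ :=
  ∑ a : F, ∑ b : F, ∑ x ∈ Finset.univ.filter (fun x : ZMod q => x ≠ 0),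
    ∑ y ∈ Finset.univ.filter (fun y : ZMod q => y ≠ 0),
      ∑ z ∈ Finset.univ.filter (fun z : ZMod q => z ≠ 0),
        zetaQ q (x * Algebra.trace (ZMod q) F (a ^ 2)) *
          zetaQ q (y * Algebra.trace (ZMod q) F (b ^ 2)) *
          zetaQ q (z * Algebra.trace (ZMod q) F (α * b + β * a) - z * lam)

/-- The `ℂ`-valued quadratic character of a finite field. -/
noncomputable abbrev complexQuadraticChar (F : Type*) [Field F] [Fintype F] [DecidableEq F] :
    MulChar F ℂ :=
  (quadraticChar F).ringHomComp (Int.castRingHom ℂ)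

section QuadraticSums

variable {F : Type*} [Field F] [Fintype F] [DecidableEq F]

theorem complexQuadraticChar_ne_one (hF : ringChar F ≠ 2) : complexQuadraticChar F ≠ 1 := by
  obtain ⟨a, ha⟩ := quadraticChar_exists_neg_one' hF
  intro h
  have h1 := congrArg (fun χ : MulChar F ℂ => χ a) h
  norm_num [ha] at h1

theorem complexQuadraticChar_mul_self {a : F} (ha : a ≠ 0) :
    complexQuadraticChar F a * complexQuadraticChar F a = 1 := by
  have h := quadraticChar_sq_one ha
  rw [sq] at h
  simp only [MulChar.ringHomComp_apply, ← map_mul, h, map_one]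

theorem complexQuadraticChar_inv (a : F) :
    complexQuadraticChar F a⁻¹ = complexQuadraticChar F a := by
  by_cases ha : a = 0
  · simp [ha]
  · have h := complexQuadraticChar_mul_self ha
    have h2 : complexQuadraticChar F a * complexQuadraticChar F a⁻¹ = 1 := by
      rw [← map_mul, mul_inv_cancel₀ ha, map_one]
    exact mul_left_cancel₀ (left_ne_zero_of_mul_eq_one h) (h2.trans h.symm)

theorem sum_complexQuadraticChar_mul_addChar (ψ : AddChar F ℂ) {c : F} (hc : c ≠ 0) :
    ∑ t, complexQuadraticChar F t * ψ (c * t) =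
      complexQuadraticChar F c * gaussSum (complexQuadraticChar F) ψ := by
  have h := gaussSum_mulShift (complexQuadraticChar F) ψ (Units.mk0 c hc)
  rw [Units.val_mk0] at h
  rw [← h, ← mul_assoc, complexQuadraticChar_mul_self hc, one_mul]
  rfl

theorem sum_addChar_mul_sq (hF : ringChar F ≠ 2) {ψ : AddChar F ℂ} (hψ : ψ.IsPrimitive)
    {c : F} (hc : c ≠ 0) :
    ∑ a, ψ (c * a ^ 2) = complexQuadraticChar F c * gaussSum (complexQuadraticChar F) ψ := by
  have hfib : ∑ a, ψ (c * a ^ 2) = ∑ t, (complexQuadraticChar F t + 1) * ψ (c * t) := by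
    rw [← Finset.sum_fiberwise univ (fun a : F => a ^ 2)]
    refine Finset.sum_congr rfl fun t _ => ?_
    have hcard := quadraticChar_card_sqrts hF t
    have hset : {x : F | x ^ 2 = t}.toFinset = univ.filter (fun x : F => x ^ 2 = t) := by
      ext; simp
    rw [hset] at hcard
    have hcast : ((univ.filter (fun x : F => x ^ 2 = t)).card : ℂ) =
        complexQuadraticChar F t + 1 := by
      have := congrArg (Int.cast : ℤ → ℂ) hcard
      simpa using this
    rw [← hcast, ← nsmul_eq_mul]
    refine Finset.sum_eq_card_nsmul fun a ha => ?_
    rw [(Finset.mem_filter.mp ha).2]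
  have hlin : ∑ t, ψ (c * t) = 0 := by
    have h := AddChar.sum_mulShift c hψ
    rw [if_neg hc, Nat.cast_zero] at h
    simpa only [mul_comm] using h
  simp_rw [hfib, add_mul, one_mul, Finset.sum_add_distrib]
  rw [hlin, add_zero, sum_complexQuadraticChar_mul_addChar ψ hc]

theorem sum_addChar_quadratic (hF : ringChar F ≠ 2) {ψ : AddChar F ℂ} (hψ : ψ.IsPrimitive)
    {c : F} (hc : c ≠ 0) (d : F) :
    ∑ a, ψ (c * a ^ 2 + d * a) =
      complexQuadraticChar F c * gaussSum (complexQuadraticChar F) ψ *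
        ψ (-(d ^ 2 * (4 * c)⁻¹)) := by
  have h2 : (2 : F) ≠ 0 := Ring.two_ne_zero hF
  have h4 : (4 : F) ≠ 0 := by
    have : (4 : F) = 2 * 2 := by norm_num
    rw [this]; exact mul_ne_zero h2 h2
  rw [← sum_addChar_mul_sq hF hψ hc, Finset.sum_mul]
  conv_rhs => rw [← Equiv.sum_comp (Equiv.addRight (d * (2 * c)⁻¹))]
  refine Finset.sum_congr rfl fun a _ => ?_
  rw [← AddChar.map_add_eq_mul]
  congr 1
  simp only [Equiv.coe_addRight]
  field_simp
  ring

theorem sum_complexQuadraticChar_mul_addChar_inv (hF : ringChar F ≠ 2) (ψ : AddChar F ℂ) (c : F) :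
    ∑ t, complexQuadraticChar F t * ψ (c * t⁻¹) =
      complexQuadraticChar F c * gaussSum (complexQuadraticChar F) ψ := by
  by_cases hc : c = 0
  · simpa [hc] using MulChar.sum_eq_zero_of_ne_one (complexQuadraticChar_ne_one hF)
  · rw [← sum_complexQuadraticChar_mul_addChar ψ hc, ← Equiv.sum_comp (Equiv.inv F)]
    simp [-MulChar.ringHomComp_apply, complexQuadraticChar_inv]

end QuadraticSums

theorem quadraticChar_algebraMap_of_odd {K F : Type*} [Field K] [Fintype K] [DecidableEq K]
    [Field F] [Fintype F] [DecidableEq F] [Algebra K F] (hK : ringChar K ≠ 2)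
    (hF : ringChar F ≠ 2) {m : ℕ} (hm : Odd m)
    (hcard : Fintype.card F = Fintype.card K ^ m) (x : K) :
    quadraticChar F (algebraMap K F x) = quadraticChar K x := by
  by_cases hx : x = 0
  · simp [hx]
  obtain ⟨k, hk⟩ : Odd (Fintype.card K) :=
    Nat.odd_iff.mpr (FiniteField.odd_card_of_char_ne_two hK)
  set S := ∑ i ∈ Finset.range m, Fintype.card K ^ i with hS
  have hSodd : Odd S := by
    rw [hS, Finset.odd_sum_iff_odd_card_odd, Finset.filter_true_of_mem, Finset.card_range]
    · exact hm
    · exact fun i _ => Odd.pow ⟨k, hk⟩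
  have hhalf : Fintype.card F / 2 = Fintype.card K / 2 * S := by
    have h := geom_sum_mul_add (2 * k) m
    rw [← hk, ← hS, ← hcard] at h
    have h' : S * (2 * k) = 2 * (k * S) := by ring
    have hk2 : Fintype.card K / 2 = k := by omega
    rw [hk2]
    omega
  have key : ((quadraticChar F (algebraMap K F x) : ℤ) : F) = ((quadraticChar K x : ℤ) : F) := by
    rw [quadraticChar_eq_pow_of_char_ne_two' hF, hhalf, pow_mul, ← map_pow,
      ← quadraticChar_eq_pow_of_char_ne_two' hK, map_intCast]
    rcases quadraticChar_dichotomy hx with h | h <;> simp [h, hSodd.neg_one_pow]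
  have hx' : algebraMap K F x ≠ 0 := by simpa using hx
  have hne := Ring.neg_one_ne_one_of_char_ne_two hF
  rcases quadraticChar_dichotomy hx with h | h <;>
    rcases quadraticChar_dichotomy hx' with h' | h' <;>
    simp_all [hne.symm]

theorem zetaQ_eq_stdAddChar (q : ℕ) [Fact q.Prime] (s : ZMod q) :
    zetaQ q s = ZMod.stdAddChar s := by
  have h := ZMod.stdAddChar_coe (N := q) (s.val : ℤ)
  simp only [Int.cast_natCast, ZMod.natCast_zmod_val] at h
  rw [h, zetaQ]

/-- The additive character `x ↦ exp(2πi·Tr(x)/q)` of an extension of `ZMod q`. -/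
noncomputable def traceAddChar (q : ℕ) [Fact q.Prime] (F : Type*) [Field F] [Fintype F]
    [Algebra (ZMod q) F] : AddChar F ℂ :=
  (ZMod.stdAddChar (N := q)).compAddMonoidHom (Algebra.trace (ZMod q) F).toAddMonoidHom

section Trace

variable {q : ℕ} [Fact q.Prime] {F : Type*} [Field F] [Fintype F] [Algebra (ZMod q) F]

theorem traceAddChar_apply (x : F) :
    traceAddChar q F x = ZMod.stdAddChar (Algebra.trace (ZMod q) F x) := rfl

theorem traceAddChar_isPrimitive : (traceAddChar q F).IsPrimitive := by
  apply AddChar.IsPrimitive.of_ne_one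
  intro h
  obtain ⟨x, hx⟩ := Algebra.trace_surjective (ZMod q) F 1
  have h1 : traceAddChar q F x = 1 := by rw [h]; rfl
  rw [traceAddChar_apply, hx] at h1
  have h0 : ZMod.stdAddChar (1 : ZMod q) = ZMod.stdAddChar (0 : ZMod q) := by
    rw [h1, AddChar.map_zero_eq_one]
  exact one_ne_zero (ZMod.injective_stdAddChar h0)

theorem gaussSmall_eq_gaussSum :
    gaussSmall q = gaussSum (complexQuadraticChar (ZMod q)) ZMod.stdAddChar := by
  rw [gaussSmall, gaussSum, Finset.sum_filter]
  refine Finset.sum_congr rfl fun y _ => ?_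
  by_cases hy : y = 0 <;> simp [hy, zetaQ_eq_stdAddChar]

theorem gaussBig_eq_gaussSum [DecidableEq F] :
    gaussBig q F = gaussSum (complexQuadraticChar F) (traceAddChar q F) := by
  rw [gaussBig, gaussSum, Finset.sum_filter]
  refine Finset.sum_congr rfl fun y _ => ?_
  by_cases hy : y = 0 <;> simp [hy, zetaQ_eq_stdAddChar, traceAddChar_apply]

/-- Completing the square in `F` for a quadratic form with coefficient in the prime field. -/
theorem sum_stdAddChar_trace_quadratic [DecidableEq F] (hq : ringChar (ZMod q) ≠ 2)
    (hF : ringChar F ≠ 2) {m : ℕ} (hm : Odd m) (hcard : Fintype.card F = q ^ m) (γ : F)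
    {x : ZMod q} (hx : x ≠ 0) (z : ZMod q) :
    ∑ a : F, (ZMod.stdAddChar (x * Algebra.trace (ZMod q) F (a ^ 2)) *
        ZMod.stdAddChar (z * Algebra.trace (ZMod q) F (γ * a)) : ℂ) =
      gaussBig q F * (complexQuadraticChar (ZMod q) x *
        ZMod.stdAddChar (-(z ^ 2 * 4⁻¹ * Algebra.trace (ZMod q) F (γ ^ 2)) * x⁻¹)) := by
  have hx' : algebraMap (ZMod q) F x ≠ 0 := by simpa using hx
  have hchar : complexQuadraticChar F (algebraMap (ZMod q) F x) =
      complexQuadraticChar (ZMod q) x := by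
    simp only [MulChar.ringHomComp_apply]
    rw [quadraticChar_algebraMap_of_odd hq hF hm (by rw [hcard, ZMod.card])]
  have h := sum_addChar_quadratic hF (traceAddChar_isPrimitive (q := q) (F := F)) hx'
    (algebraMap (ZMod q) F z * γ)
  rw [hchar, ← gaussBig_eq_gaussSum] at h
  have harg : -((algebraMap (ZMod q) F z * γ) ^ 2 * (4 * algebraMap (ZMod q) F x)⁻¹) =
      (-(z ^ 2 * 4⁻¹ * x⁻¹)) • γ ^ 2 := by
    rw [Algebra.smul_def]
    simp only [map_neg, map_mul, map_pow, map_inv₀, map_ofNat, mul_inv]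
    ring
  rw [harg, traceAddChar_apply, map_smul, smul_eq_mul] at h
  calc _ = ∑ a : F, traceAddChar q F
        (algebraMap (ZMod q) F x * a ^ 2 + algebraMap (ZMod q) F z * γ * a) := by
        refine Finset.sum_congr rfl fun a _ => ?_
        rw [← AddChar.map_add_eq_mul, traceAddChar_apply, mul_assoc, ← Algebra.smul_def,
          ← Algebra.smul_def, map_add (Algebra.trace (ZMod q) F), map_smul, map_smul, smul_eq_mul, smul_eq_mul]
    _ = _ := by
        rw [h, mul_comm (complexQuadraticChar (ZMod q) x), mul_assoc]
        congr 3
        ring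

theorem sum_filter_complexQuadraticChar_mul_stdAddChar_inv (hq : ringChar (ZMod q) ≠ 2)
    {z : ZMod q} (hz : z ≠ 0) (t : ZMod q) :
    ∑ x ∈ univ.filter (fun x : ZMod q => x ≠ 0), complexQuadraticChar (ZMod q) x *
        ZMod.stdAddChar (-(z ^ 2 * 4⁻¹ * t) * x⁻¹) =
      complexQuadraticChar (ZMod q) (-1) * complexQuadraticChar (ZMod q) t * gaussSmall q := by
  have h2 : (2 : ZMod q) ≠ 0 := Ring.two_ne_zero hq
  have harg : -(z ^ 2 * 4⁻¹ * t) = (-1) * t * ((z * 2⁻¹) * (z * 2⁻¹)) := by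
    have : (4 : ZMod q) = 2 * 2 := by norm_num
    rw [this, mul_inv]; ring
  rw [Finset.sum_filter_of_ne (p := fun x : ZMod q => x ≠ 0),
    sum_complexQuadraticChar_mul_addChar_inv hq, gaussSmall_eq_gaussSum, harg, map_mul _ (-1 * t),
    map_mul _ (z * 2⁻¹), complexQuadraticChar_mul_self (mul_ne_zero hz (inv_ne_zero h2)), mul_one,
    map_mul]
  rintro x - hne rfl
  simp at hne

theorem sum_filter_stdAddChar_neg_mul {lam : ZMod q} (hlam : lam ≠ 0) :
    ∑ z ∈ univ.filter (fun z : ZMod q => z ≠ 0), (ZMod.stdAddChar (-(z * lam)) : ℂ) = -1 := by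
  have h := AddChar.sum_mulShift (-lam) (ZMod.isPrimitive_stdAddChar q)
  rw [if_neg (neg_ne_zero.mpr hlam), Nat.cast_zero,
    ← Finset.sum_filter_add_sum_filter_not univ (fun z : ZMod q => z ≠ 0)] at h
  simp only [not_not, Finset.filter_eq', Finset.mem_univ, if_true, Finset.sum_singleton, zero_mul,
    AddChar.map_zero_eq_one] at h
  simp only [mul_neg] at h
  exact eq_neg_of_add_eq_zero_left h

theorem Nthree_eq [DecidableEq F] (hq : ringChar (ZMod q) ≠ 2)
    (hF : ringChar F ≠ 2) {m : ℕ} (hm : Odd m) (hcard : Fintype.card F = q ^ m) (α β : F)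
    {lam : ZMod q} (hlam : lam ≠ 0) :
    Nthree q F α β lam =
      -(complexQuadraticChar (ZMod q)
          (Algebra.trace (ZMod q) F (α ^ 2) * Algebra.trace (ZMod q) F (β ^ 2))) *
        gaussBig q F ^ 2 * gaussSmall q ^ 2 := by
  set T : F → ZMod q := fun x => Algebra.trace (ZMod q) F x with hT
  set e : ZMod q → ℂ := fun x => ZMod.stdAddChar x with he
  set χ := complexQuadraticChar (ZMod q) with hχ
  set U := univ.filter (fun x : ZMod q => x ≠ 0) with hU
  have hadd (a b : ZMod q) : e (a + b) = e a * e b := AddChar.map_add_eq_mul _ a b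
  have hsep : Nthree q F α β lam = ∑ z ∈ U, e (-(z * lam)) *
      ((∑ x ∈ U, ∑ a : F, e (x * T (a ^ 2)) * e (z * T (β * a))) *
        (∑ y ∈ U, ∑ b : F, e (y * T (b ^ 2)) * e (z * T (α * b)))) := by
    have hterm (a b : F) (x y z : ZMod q) :
        e (x * T (a ^ 2)) * e (y * T (b ^ 2)) * e (z * T (α * b + β * a) - z * lam) =
        e (-(z * lam)) * ((e (x * T (a ^ 2)) * e (z * T (β * a))) *
          (e (y * T (b ^ 2)) * e (z * T (α * b)))) := by
      have : z * T (α * b + β * a) - z * lam =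
          z * T (α * b) + z * T (β * a) + -(z * lam) := by
        simp only [hT, map_add]; ring
      rw [this, hadd, hadd]; ring
    simp only [Nthree, zetaQ_eq_stdAddChar]
    change ∑ a : F, ∑ b : F, ∑ x ∈ U, ∑ y ∈ U, ∑ z ∈ U, e (x * T (a ^ 2)) *
      e (y * T (b ^ 2)) * e (z * T (α * b + β * a) - z * lam) = _
    simp_rw [hterm]
    calc _ = ∑ a : F, ∑ b : F, ∑ z ∈ U, ∑ x ∈ U, ∑ y ∈ U, e (-(z * lam)) *
          ((e (x * T (a ^ 2)) * e (z * T (β * a))) *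
            (e (y * T (b ^ 2)) * e (z * T (α * b)))) := by
          refine Finset.sum_congr rfl fun a _ => Finset.sum_congr rfl fun b _ => ?_
          rw [Finset.sum_comm]
          conv_rhs => rw [Finset.sum_comm]; enter [2, x]; rw [Finset.sum_comm]
          rw [Finset.sum_comm]
      _ = ∑ z ∈ U, ∑ a : F, ∑ b : F, ∑ x ∈ U, ∑ y ∈ U, e (-(z * lam)) *
          ((e (x * T (a ^ 2)) * e (z * T (β * a))) *
            (e (y * T (b ^ 2)) * e (z * T (α * b)))) := by
          conv_rhs => rw [Finset.sum_comm]; enter [2, a]; rw [Finset.sum_comm]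
      _ = _ := by
          refine Finset.sum_congr rfl fun z _ => ?_
          rw [Finset.sum_comm (s := U) (t := univ), Finset.sum_comm (s := U) (t := univ),
            Finset.sum_mul_sum]
          simp_rw [Finset.sum_mul_sum, Finset.mul_sum]
  have hfactor (γ : F) {z : ZMod q} (hz : z ∈ U) :
      ∑ x ∈ U, ∑ a : F, e (x * T (a ^ 2)) * e (z * T (γ * a)) =
        gaussBig q F * (χ (-1) * χ (T (γ ^ 2)) * gaussSmall q) := by
    rw [← sum_filter_complexQuadraticChar_mul_stdAddChar_inv hq (Finset.mem_filter.mp hz).2,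
      Finset.mul_sum]
    exact Finset.sum_congr rfl fun x hx =>
      sum_stdAddChar_trace_quadratic hq hF hm hcard γ (Finset.mem_filter.mp hx).2 z
  have hneg : χ (-1) * χ (-1) = 1 := complexQuadraticChar_mul_self (by simp)
  rw [hsep, Finset.sum_congr rfl fun z hz => by rw [hfactor β hz, hfactor α hz],
    ← Finset.sum_mul, sum_filter_stdAddChar_neg_mul hlam, map_mul]
  linear_combination (-(gaussBig q F ^ 2 * gaussSmall q ^ 2 * χ (T (α ^ 2)) *
    χ (T (β ^ 2)))) * hneg

end Trace

theorem stmt5 (q m : ℕ) [Fact q.Prime] (hq : Odd q) (hm : 2 ≤ m) (hmodd : Odd m)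
    (F : Type*) [Field F] [Fintype F] [DecidableEq F] [Algebra (ZMod q) F]
    (hF : Fintype.card F = q ^ m) (α β : F) (hα : α ≠ 0) (hβ : β ≠ 0)
    (lam : ZMod q) (hlam : lam ≠ 0) :
    (Algebra.trace (ZMod q) F (α ^ 2) ≠ 0 → Algebra.trace (ZMod q) F (β ^ 2) ≠ 0 →
      Nthree q F α β lam =
        -(quadraticChar (ZMod q)
            (Algebra.trace (ZMod q) F (α ^ 2) * Algebra.trace (ZMod q) F (β ^ 2)) : ℂ) *
          (gaussBig q F) ^ 2 * (gaussSmall q) ^ 2) ∧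
    (Algebra.trace (ZMod q) F (α ^ 2) = 0 ∨ Algebra.trace (ZMod q) F (β ^ 2) = 0 →
      Nthree q F α β lam = 0) := by
  have hq2 : q ≠ 2 := by rintro rfl; exact absurd hq (by decide)
  have hK : ringChar (ZMod q) ≠ 2 := by rwa [ZMod.ringChar_zmod_n]
  have hF2 : ringChar F ≠ 2 := by
    rwa [← Algebra.ringChar_eq (ZMod q) F]
  have h := Nthree_eq hK hF2 hmodd hF α β hlam
  refine ⟨fun _ _ => by simpa using h, fun h0 => ?_⟩
  have hprod : Algebra.trace (ZMod q) F (α ^ 2) * Algebra.trace (ZMod q) F (β ^ 2) = 0 :=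
    mul_eq_zero.mpr h0
  rw [h, hprod, MulChar.map_zero, neg_zero, zero_mul, zero_mul]
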